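/- There exists a pointed full-dimensional rational cone $C\subseteq\mathbb{R}^6$ that satisfies the integral Carathéodory property (ICP) but does not satisfy (UHC); that is, every lattice point of $C$ is a nonnegative integer combination of at most $6$ elements of $\operatorname{Hilb}(C)$, yet $C$ is not the union of its $u$-subcones. -/

import Mathlib

/-- The real vector corresponding to an integer vector. -/
def toR {d : ℕ} (x : Fin d → ℤ) : Fin d → ℝ := fun i => (x i : ℝ)

/-- The cone generated by a finite family of integer vectors. -/
def coneFin {d n : ℕ} (v : Fin n → (Fin d → ℤ)) : Set (Fin d → ℝ) :=
  { y | ∃ a : Fin n → ℝ, (∀ i, 0 ≤ a i) ∧ y = ∑ i, a i • toR (v i) }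

/-- The cone generated by a set of integer vectors (nonnegative real combinations
of finitely many of its elements). -/
def coneSet {d : ℕ} (B : Set (Fin d → ℤ)) : Set (Fin d → ℝ) :=
  { y | ∃ (n : ℕ) (v : Fin n → (Fin d → ℤ)) (a : Fin n → ℝ),
      (∀ i, v i ∈ B) ∧ (∀ i, 0 ≤ a i) ∧ y = ∑ i, a i • toR (v i) }

/-- A finitely generated rational cone. -/
def IsRatCone {d : ℕ} (C : Set (Fin d → ℝ)) : Prop :=
  ∃ B : Finset (Fin d → ℤ), C = coneSet (B : Set (Fin d → ℤ))

/-- A pointed cone: `x, -x ∈ C` implies `x = 0`. -/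
def PointedSet {d : ℕ} (C : Set (Fin d → ℝ)) : Prop :=
  ∀ x ∈ C, -x ∈ C → x = 0

/-- A full-dimensional subset of `ℝ^d`. -/
def FullDim {d : ℕ} (C : Set (Fin d → ℝ)) : Prop :=
  Submodule.span ℝ C = ⊤

/-- The Hilbert basis of the monoid `C ∩ ℤ^d`: the nonzero lattice points of `C`
admitting no decomposition into two nonzero lattice points of `C`. -/
def hilbC {d : ℕ} (C : Set (Fin d → ℝ)) : Set (Fin d → ℤ) :=
  { z | toR z ∈ C ∧ z ≠ 0 ∧
    ¬∃ u v : Fin d → ℤ, toR u ∈ C ∧ toR v ∈ C ∧ u ≠ 0 ∧ v ≠ 0 ∧ z = u + v }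

namespace ConeUHC

/-- Integer vectors in dimension six, stored by coordinates for fast evaluation. -/
@[ext] structure V6 where
  (a b c d e f : ℤ)
deriving DecidableEq

namespace V6

/-- The standard bilinear pairing. -/
def dot (h x : V6) : ℤ :=
  h.a * x.a + h.b * x.b + h.c * x.c + h.d * x.d + h.e * x.e + h.f * x.f

/-- Coordinatewise addition. -/
def add (x y : V6) : V6 :=
  ⟨x.a + y.a, x.b + y.b, x.c + y.c, x.d + y.d, x.e + y.e, x.f + y.f⟩

/-- Scalar multiplication. -/
def smul (n : ℤ) (x : V6) : V6 :=
  ⟨n * x.a, n * x.b, n * x.c, n * x.d, n * x.e, n * x.f⟩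

/-- The zero vector. -/
def zero : V6 := ⟨0, 0, 0, 0, 0, 0⟩

/-- The standard basis. -/
def basis : List V6 :=
  [⟨1, 0, 0, 0, 0, 0⟩, ⟨0, 1, 0, 0, 0, 0⟩, ⟨0, 0, 1, 0, 0, 0⟩,
   ⟨0, 0, 0, 1, 0, 0⟩, ⟨0, 0, 0, 0, 1, 0⟩, ⟨0, 0, 0, 0, 0, 1⟩]

/-- The underlying function of a vector. -/
def vec (x : V6) : Fin 6 → ℤ := ![x.a, x.b, x.c, x.d, x.e, x.f]

/-- The vector with the coordinates of a function. -/
def ofFun (x : Fin 6 → ℤ) : V6 := ⟨x 0, x 1, x 2, x 3, x 4, x 5⟩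

/-- The reduction modulo two. -/
def mod2 (x : V6) : V6 := ⟨x.a % 2, x.b % 2, x.c % 2, x.d % 2, x.e % 2, x.f % 2⟩

/-- The pairing of an integer functional with a real vector. -/
def dotR (h : V6) (x : Fin 6 → ℝ) : ℝ :=
  h.a * x 0 + h.b * x 1 + h.c * x 2 + h.d * x 3 + h.e * x 4 + h.f * x 5

/-- The representatives of all residue classes modulo two. -/
def residues : List V6 :=
  [0, 1].flatMap fun a => [0, 1].flatMap fun b => [0, 1].flatMap fun c =>
    [0, 1].flatMap fun d => [0, 1].flatMap fun e => [0, 1].map fun f => ⟨a, b, c, d, e, f⟩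

theorem vec_ofFun (x : Fin 6 → ℤ) : (ofFun x).vec = x := by
  ext i; fin_cases i <;> rfl

theorem ofFun_vec (x : V6) : ofFun x.vec = x := rfl

theorem vec_add (x y : V6) : (x.add y).vec = x.vec + y.vec := by
  ext i; fin_cases i <;> rfl

theorem vec_smul (n : ℤ) (x : V6) : (smul n x).vec = n • x.vec := by
  ext i; fin_cases i <;> rfl

theorem vec_zero : zero.vec = 0 := by
  ext i; fin_cases i <;> rfl

theorem vec_injective : Function.Injective vec :=
  Function.LeftInverse.injective ofFun_vec

theorem dot_add (h x y : V6) : h.dot (x.add y) = h.dot x + h.dot y := by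
  simp only [dot, add]; ring

theorem dot_smul (h : V6) (n : ℤ) (x : V6) : h.dot (smul n x) = n * h.dot x := by
  simp only [dot, smul]; ring

theorem add_dot (h k x : V6) : (h.add k).dot x = h.dot x + k.dot x := by
  simp only [dot, add]; ring

theorem smul_dot (h : V6) (n : ℤ) (x : V6) : (smul n h).dot x = n * h.dot x := by
  simp only [dot, smul]; ring

theorem smul_cancel {n : ℤ} (hn : 0 < n) {x y : V6} (h : smul n x = smul n y) : x = y := by
  simp only [smul, V6.mk.injEq] at h
  obtain ⟨h1, h2, h3, h4, h5, h6⟩ := h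
  have key := fun {s t : ℤ} (e : n * s = n * t) => mul_left_cancel₀ hn.ne' e
  exact V6.ext (key h1) (key h2) (key h3) (key h4) (key h5) (key h6)

theorem mod2_mem_residues (x : V6) : x.mod2 ∈ residues := by
  have key : ∀ t : ℤ, t % 2 = 0 ∨ t % 2 = 1 := fun t => Int.emod_two_eq_zero_or_one t
  simp only [mod2, residues, List.mem_flatMap, List.mem_map, List.mem_cons, List.not_mem_nil,
    or_false]
  exact ⟨_, key _, _, key _, _, key _, _, key _, _, key _, _, key _, rfl⟩

theorem two_dvd_dot_sub_dot_mod2 (h x : V6) : 2 ∣ h.dot x - h.dot x.mod2 := by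
  have key : ∀ s t : ℤ, (2 : ℤ) ∣ s * t - s * (t % 2) := fun s t => by
    rw [← mul_sub]
    exact Dvd.dvd.mul_left (Int.dvd_self_sub_emod) s
  have := dvd_add (dvd_add (dvd_add (dvd_add (dvd_add (key h.a x.a) (key h.b x.b))
    (key h.c x.c)) (key h.d x.d)) (key h.e x.e)) (key h.f x.f)
  simp only [dot, mod2]
  refine (congrArg ((2 : ℤ) ∣ ·) ?_).mpr this
  ring

theorem dotR_toR_vec (h x : V6) : h.dotR (toR x.vec) = h.dot x := by
  simp [dotR, toR, vec, dot]

theorem dotR_smul (h : V6) (t : ℝ) (x : Fin 6 → ℝ) : h.dotR (t • x) = t * h.dotR x := by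
  simp only [dotR, Pi.smul_apply, smul_eq_mul]; ring

theorem dotR_neg (h : V6) (x : Fin 6 → ℝ) : h.dotR (-x) = -h.dotR x := by
  simp only [dotR, Pi.neg_apply]; ring

theorem dotR_sum {ι : Type*} (h : V6) (s : Finset ι) (x : ι → Fin 6 → ℝ) :
    h.dotR (∑ i ∈ s, x i) = ∑ i ∈ s, h.dotR (x i) := by
  simp only [dotR, Finset.sum_apply, Finset.mul_sum, Finset.sum_add_distrib]

end V6

open V6

/-- The linear combination of a list of vectors with a list of coefficients. -/
def lin : List ℤ → List V6 → V6
  | n :: c, v :: K => (smul n v).add (lin c K)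
  | _, _ => zero

/-- The pairings of a vector with a list of functionals. -/
def pairings (rows : List V6) (x : V6) : List ℤ := rows.map fun h => h.dot x

theorem mem_pairings_nonneg {rows : List V6} {x : V6} (h : ∀ r ∈ rows, 0 ≤ r.dot x) :
    ∀ t ∈ pairings rows x, 0 ≤ t := by
  simpa [pairings] using h

/-- `rows`, up to the scalar `m`, is a system of coordinates with respect to `K`. -/
def isDual (m : ℤ) (rows K : List V6) : Bool :=
  basis.all fun e => decide (lin (pairings rows e) K = smul m e)

theorem lin_pairings_eq (rows K : List V6) (x : V6) :
    lin (pairings rows x) K =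
      lin [x.a, x.b, x.c, x.d, x.e, x.f] (basis.map fun e => lin (pairings rows e) K) := by
  induction rows generalizing K with
  | nil => simp [pairings, lin, basis, add, smul, zero]
  | cons r rows ih =>
    cases K with
    | nil => simp [pairings, lin, basis, add, smul, zero]
    | cons v K =>
      have := ih K
      simp only [pairings, List.map_cons, lin, basis, List.map_nil] at this ⊢
      rw [this]
      simp only [add, smul, zero, dot, V6.mk.injEq]
      refine ⟨?_, ?_, ?_, ?_, ?_, ?_⟩ <;> ring

theorem isDual.lin_eq {m : ℤ} {rows K : List V6} (h : isDual m rows K = true) (x : V6) :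
    lin (pairings rows x) K = smul m x := by
  rw [lin_pairings_eq]
  simp only [isDual, List.all_eq_true, decide_eq_true_eq] at h
  rw [List.map_congr_left h]
  simp [basis, lin, smul, add, zero, mul_comm]

theorem dot_lin (h : V6) (c : List ℤ) (K : List V6) (hc : ∀ t ∈ c, 0 ≤ t)
    (hK : ∀ v ∈ K, 0 ≤ h.dot v) : 0 ≤ h.dot (lin c K) := by
  induction c generalizing K with
  | nil => simp [lin, dot, zero]
  | cons n c ih =>
    cases K with
    | nil => simp [lin, dot, zero]
    | cons v K =>
      simp only [lin, dot_add, dot_smul]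
      have h1 := mul_nonneg (hc n (by simp)) (hK v (by simp))
      have h2 := ih K (fun t ht => hc t (by simp [ht])) (fun w hw => hK w (by simp [hw]))
      exact add_nonneg h1 h2

/-- The vector `x` lies in the rational cone generated by the list `K`. -/
def InCone (K : List V6) (x : V6) : Prop :=
  ∃ (m : ℤ) (c : List ℤ), 0 < m ∧ c.length = K.length ∧ (∀ t ∈ c, 0 ≤ t) ∧ smul m x = lin c K

theorem InCone.dot_nonneg {K : List V6} {x h : V6} (hx : InCone K x)
    (hK : ∀ v ∈ K, 0 ≤ h.dot v) : 0 ≤ h.dot x := by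
  obtain ⟨m, c, hm, -, hc, e⟩ := hx
  have := dot_lin h c K hc hK
  rw [← e, dot_smul] at this
  exact nonneg_of_mul_nonneg_right this hm

theorem lin_set (γ : List ℤ) (K : List V6) (i : ℕ) (n : ℤ) (v : V6) (hc : i < γ.length)
    (hK : i < K.length) :
    (lin (γ.set i n) (K.set i v)).add (smul γ[i] K[i]) = (lin γ K).add (smul n v) := by
  induction γ generalizing K i with
  | nil => simp at hc
  | cons t γ ih =>
    cases K with
    | nil => simp at hK
    | cons w K =>
      cases i with
      | zero =>
        simp only [List.set_cons_zero, lin, List.getElem_cons_zero, add, smul, V6.mk.injEq]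
        refine ⟨?_, ?_, ?_, ?_, ?_, ?_⟩ <;> ring
      | succ i =>
        have := ih K i (by simpa using hc) (by simpa using hK)
        simp only [List.set_cons_succ, lin, List.getElem_cons_succ, add, smul, V6.mk.injEq]
          at this ⊢
        obtain ⟨h1, h2, h3, h4, h5, h6⟩ := this
        refine ⟨?_, ?_, ?_, ?_, ?_, ?_⟩ <;> linarith

theorem lin_map_mul (n : ℤ) (c : List ℤ) (K : List V6) :
    lin (c.map (n * ·)) K = smul n (lin c K) := by
  induction c generalizing K with
  | nil => simp [lin, smul, zero]
  | cons t c ih =>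
    cases K with
    | nil => simp [lin, smul, zero]
    | cons w K =>
      simp only [List.map_cons, lin, ih, add, smul, V6.mk.injEq]
      refine ⟨?_, ?_, ?_, ?_, ?_, ?_⟩ <;> ring

/-- Replacing the generator `K[i]` by a ray `v` in the plane of `K[i]` and `K[j]`. -/
theorem InCone.set_of_le {K : List V6} {x v : V6} {m s a b : ℤ} {γ : List ℤ} {i j : ℕ}
    (hi : i < K.length) (hj : j < K.length) (hij : i ≠ j) (hm : 0 < m) (hs : 0 < s) (ha : 0 < a)
    (hc : γ.length = K.length) (hc0 : ∀ t ∈ γ, 0 ≤ t) (e : smul m x = lin γ K)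
    (hv : smul s v = (smul a K[i]).add (smul b K[j]))
    (hle : γ[i] * b ≤ γ[j] * a) : InCone (K.set i v) x := by
  have hci : 0 ≤ γ[i] := hc0 _ (List.getElem_mem _)
  let c1 := γ.map (a * ·)
  let c2 := c1.set j (a * γ[j] - b * γ[i])
  refine ⟨a * m, c2.set i (s * γ[i]), mul_pos ha hm, by simp [c1, c2, hc], ?_, ?_⟩
  · intro t ht
    rcases List.mem_or_eq_of_mem_set ht with ht | rfl
    · rcases List.mem_or_eq_of_mem_set ht with ht | rfl
      · obtain ⟨u, hu, rfl⟩ := List.mem_map.1 ht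
        exact mul_nonneg ha.le (hc0 u hu)
      · linarith
    · exact mul_nonneg hs.le hci
  · have e1 : lin c1 K = smul a (lin γ K) := lin_map_mul a γ K
    have e2 := lin_set c1 K j (a * γ[j] - b * γ[i]) K[j] (by simp [c1]; omega) hj
    have e3 := lin_set c2 K i (s * γ[i]) v (by simp [c1, c2]; omega) hi
    rw [List.set_getElem_self] at e2
    have g1 : c1[j]'(by simp [c1]; omega) = a * γ[j] := by simp [c1]
    have g2 : c2[i]'(by simp [c1, c2]; omega) = a * γ[i] := by
      simp [c1, c2, List.getElem_set_ne hij.symm]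
    rw [g1, e1] at e2
    rw [g2] at e3
    change (lin c2 K).add _ = _ at e2
    simp only [add, smul, V6.mk.injEq] at e2 e3 hv
    rw [V6.ext_iff] at e ⊢
    simp only [smul] at e ⊢
    obtain ⟨p1, p2, p3, p4, p5, p6⟩ := e
    obtain ⟨q1, q2, q3, q4, q5, q6⟩ := e2
    obtain ⟨r1, r2, r3, r4, r5, r6⟩ := e3
    obtain ⟨t1, t2, t3, t4, t5, t6⟩ := hv
    refine ⟨?_, ?_, ?_, ?_, ?_, ?_⟩
    · linear_combination a * p1 - q1 - r1 - γ[i] * t1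
    · linear_combination a * p2 - q2 - r2 - γ[i] * t2
    · linear_combination a * p3 - q3 - r3 - γ[i] * t3
    · linear_combination a * p4 - q4 - r4 - γ[i] * t4
    · linear_combination a * p5 - q5 - r5 - γ[i] * t5
    · linear_combination a * p6 - q6 - r6 - γ[i] * t6

theorem InCone.split {K : List V6} {x v : V6} {s a b : ℤ} {i j : ℕ} (hx : InCone K x)
    (hi : i < K.length) (hj : j < K.length) (hij : i ≠ j) (hs : 0 < s) (ha : 0 < a) (hb : 0 < b)
    (hv : smul s v = (smul a K[i]).add (smul b K[j])) :
    InCone (K.set i v) x ∨ InCone (K.set j v) x := by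
  obtain ⟨m, γ, hm, hc, hc0, e⟩ := hx
  rcases le_total (γ[i] * b) (γ[j] * a) with h | h
  · exact .inl (InCone.set_of_le hi hj hij hm hs ha hc hc0 e hv h)
  · refine .inr (InCone.set_of_le hj hi hij.symm hm hs hb hc hc0 e ?_ h)
    rw [hv]
    simp only [add, V6.mk.injEq]
    refine ⟨?_, ?_, ?_, ?_, ?_, ?_⟩ <;> ring

/-- A simplicial cone on six of the generators, with its dual basis scaled by `den`. -/
structure Simplex where
  idx : List (Fin 12)
  den : ℤ
  rows : List V6

/-- A tree of subdivisions of a simplicial cone; `split i j s a b v l r` inserts the ray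
`v = (a K[i] + b K[j]) / s`, and the leaves name the simplices covering their cone. -/
inductive SplitTree where
  | leaf (L : List (Fin 32))
  | split (i j : ℕ) (s a b : ℤ) (v : V6) (l r : SplitTree)

/-- Linear endomorphisms, stored by rows. -/
structure Mat6 where
  (a b c d e f : V6)

/-- The image of a vector. -/
def Mat6.app (g : Mat6) (x : V6) : V6 :=
  ⟨g.a.dot x, g.b.dot x, g.c.dot x, g.d.dot x, g.e.dot x, g.f.dot x⟩

/-- The pullback of a functional. -/
def Mat6.pull (g : Mat6) (h : V6) : V6 :=
  lin [h.a, h.b, h.c, h.d, h.e, h.f] [g.a, g.b, g.c, g.d, g.e, g.f]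

theorem Mat6.pull_dot (g : Mat6) (h x : V6) : (g.pull h).dot x = h.dot (g.app x) := by
  simp only [pull, app, lin, dot, add, smul, zero]; ring

theorem Mat6.app_lin (g : Mat6) (c : List ℤ) (K : List V6) :
    g.app (lin c K) = lin c (K.map g.app) := by
  induction c generalizing K with
  | nil => simp [lin, app, dot, zero]
  | cons t c ih =>
    cases K with
    | nil => simp [lin, app, dot, zero]
    | cons w K =>
      simp only [List.map_cons, lin, ← ih]
      simp only [app, dot_add, dot_smul]
      rfl

/-- A cell of the triangulation: its rays, its functional `rho`, its neighbours (a scaling factor,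
the orbit representative of the neighbour and the symmetry carrying it there), a multiple of the
functional of its facet on the boundary, the scaling of the dual basis, and a subdivision. -/
structure Cell where
  rays : List V6
  rho : V6
  nbrs : List (ℤ × Fin 5 × Fin 7)
  facet : V6
  den : ℤ
  tree : SplitTree

/-- A reason for a set of generators, encoded by the bits of `mask`, not to generate a unimodular
cone containing a given vector: either `m = 0` and `h` separates them from that vector, or `h`
vanishes on them modulo `m`. -/
structure Obstruction where
  mask : ℕ
  h : V6
  m : ℤ

/-- The generators of the cone. -/
def gens : List V6 :=
  [⟨0, 1, 0, 0, 0, 0⟩,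
   ⟨0, 0, 1, 0, 0, 0⟩,
   ⟨0, 0, 0, 1, 0, 0⟩,
   ⟨0, 0, 0, 0, 1, 0⟩,
   ⟨0, 0, 0, 0, 0, 1⟩,
   ⟨1, 0, 2, 1, 1, 2⟩,
   ⟨1, 2, 0, 2, 1, 1⟩,
   ⟨1, 1, 2, 0, 2, 1⟩,
   ⟨1, 1, 1, 2, 0, 2⟩,
   ⟨1, 2, 1, 1, 2, 0⟩,
   ⟨0, -1, 2, -1, -1, 2⟩,
   ⟨1, 0, 3, 0, 0, 3⟩]

/-- Simplicial subcones of index at most two. -/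
def simplices : List Simplex :=
  [⟨[1, 2, 3, 4, 6, 10], 1,
    [⟨-4, 2, 1, 0, 0, 0⟩, ⟨0, -1, 0, 1, 0, 0⟩, ⟨1, -1, 0, 0, 1, 0⟩, ⟨-5, 2, 0, 0, 0, 1⟩,
      ⟨1, 0, 0, 0, 0, 0⟩, ⟨2, -1, 0, 0, 0, 0⟩]⟩,
   ⟨[1, 2, 3, 6, 8, 10], 1,
    [⟨1, 0, 1, 0, 0, -1⟩, ⟨-5, 1, 0, 1, 0, 1⟩, ⟨1, -1, 0, 0, 1, 0⟩, ⟨-4, 2, 0, 0, 0, 1⟩,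
      ⟨5, -2, 0, 0, 0, -1⟩, ⟨-3, 1, 0, 0, 0, 1⟩]⟩,
   ⟨[0, 2, 3, 4, 5, 10], 2,
    [⟨-2, 2, 1, 0, 0, 0⟩, ⟨-4, 0, 1, 2, 0, 0⟩, ⟨-4, 0, 1, 0, 2, 0⟩, ⟨0, 0, -2, 0, 0, 2⟩,
      ⟨2, 0, 0, 0, 0, 0⟩, ⟨-2, 0, 1, 0, 0, 0⟩]⟩,
   ⟨[1, 2, 3, 6, 7, 10], 2,
    [⟨-8, 4, 2, 0, 0, 0⟩, ⟨5, -4, 0, 2, 0, -1⟩, ⟨-8, 2, 0, 0, 2, 2⟩, ⟨-3, 2, 0, 0, 0, 1⟩,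
      ⟨5, -2, 0, 0, 0, -1⟩, ⟨-1, 0, 0, 0, 0, 1⟩]⟩,
   ⟨[1, 3, 4, 7, 8, 10], 2,
    [⟨-7, 3, 2, 1, 0, 0⟩, ⟨0, -4, 0, 2, 2, 0⟩, ⟨-7, 5, 0, -1, 0, 2⟩, ⟨1, 1, 0, -1, 0, 0⟩,
      ⟨1, -1, 0, 1, 0, 0⟩, ⟨2, -2, 0, 0, 0, 0⟩]⟩,
   ⟨[1, 3, 6, 8, 9, 10], 2,
    [⟨-8, 2, 2, 2, 0, 0⟩, ⟨-3, -1, 0, 1, 2, 1⟩, ⟨-8, 4, 0, 0, 0, 2⟩, ⟨5, -3, 0, 1, 0, -1⟩,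
      ⟨5, -1, 0, -1, 0, -1⟩, ⟨-1, 1, 0, -1, 0, 1⟩]⟩,
   ⟨[2, 3, 4, 8, 9, 10], 2,
    [⟨-8, 2, 2, 2, 0, 0⟩, ⟨5, -4, -1, 0, 2, 0⟩, ⟨-8, 4, 0, 0, 0, 2⟩, ⟨5, -2, -1, 0, 0, 0⟩,
      ⟨-3, 2, 1, 0, 0, 0⟩, ⟨-1, 0, 1, 0, 0, 0⟩]⟩,
   ⟨[0, 1, 2, 3, 5, 10], 2,
    [⟨-2, 2, 0, 0, 0, 1⟩, ⟨0, 0, 2, 0, 0, -2⟩, ⟨-4, 0, 0, 2, 0, 1⟩, ⟨-4, 0, 0, 0, 2, 1⟩,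
      ⟨2, 0, 0, 0, 0, 0⟩, ⟨-2, 0, 0, 0, 0, 1⟩]⟩,
   ⟨[0, 1, 2, 4, 5, 10], 1,
    [⟨1, 1, 0, 0, -1, 0⟩, ⟨-4, 0, 1, 0, 2, 0⟩, ⟨0, 0, 0, 1, -1, 0⟩, ⟨-4, 0, 0, 0, 2, 1⟩,
      ⟨1, 0, 0, 0, 0, 0⟩, ⟨1, 0, 0, 0, -1, 0⟩]⟩,
   ⟨[0, 1, 2, 3, 4, 5], 1,
    [⟨0, 1, 0, 0, 0, 0⟩, ⟨-2, 0, 1, 0, 0, 0⟩, ⟨-1, 0, 0, 1, 0, 0⟩, ⟨-1, 0, 0, 0, 1, 0⟩,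
      ⟨-2, 0, 0, 0, 0, 1⟩, ⟨1, 0, 0, 0, 0, 0⟩]⟩,
   ⟨[1, 2, 3, 4, 10, 11], 1,
    [⟨-3, 2, 1, 0, 0, 0⟩, ⟨0, -1, 0, 1, 0, 0⟩, ⟨0, -1, 0, 0, 1, 0⟩, ⟨-3, 2, 0, 0, 0, 1⟩,
      ⟨0, -1, 0, 0, 0, 0⟩, ⟨1, 0, 0, 0, 0, 0⟩]⟩,
   ⟨[1, 2, 3, 5, 10, 11], 1,
    [⟨0, 0, 1, 0, 0, -1⟩, ⟨-3, 1, 0, 1, 0, 1⟩, ⟨-3, 1, 0, 0, 1, 1⟩, ⟨3, -2, 0, 0, 0, -1⟩,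
      ⟨0, -1, 0, 0, 0, 0⟩, ⟨-2, 2, 0, 0, 0, 1⟩]⟩,
   ⟨[0, 1, 2, 3, 4, 11], 1,
    [⟨0, 1, 0, 0, 0, 0⟩, ⟨-3, 0, 1, 0, 0, 0⟩, ⟨0, 0, 0, 1, 0, 0⟩, ⟨0, 0, 0, 0, 1, 0⟩,
      ⟨-3, 0, 0, 0, 0, 1⟩, ⟨1, 0, 0, 0, 0, 0⟩]⟩,
   ⟨[0, 1, 2, 3, 5, 11], 1,
    [⟨0, 1, 0, 0, 0, 0⟩, ⟨0, 0, 1, 0, 0, -1⟩, ⟨-3, 0, 0, 1, 0, 1⟩, ⟨-3, 0, 0, 0, 1, 1⟩,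
      ⟨3, 0, 0, 0, 0, -1⟩, ⟨-2, 0, 0, 0, 0, 1⟩]⟩,
   ⟨[0, 1, 2, 4, 6, 10], 1,
    [⟨-1, 1, 0, 0, -1, 0⟩, ⟨-2, 0, 1, 0, 2, 0⟩, ⟨-1, 0, 0, 1, -1, 0⟩, ⟨-3, 0, 0, 0, 2, 1⟩,
      ⟨1, 0, 0, 0, 0, 0⟩, ⟨1, 0, 0, 0, -1, 0⟩]⟩,
   ⟨[0, 2, 4, 6, 8, 10], 1,
    [⟨-1, 1, 0, 0, -1, 0⟩, ⟨-3, 0, 1, 1, 1, 0⟩, ⟨-1, 0, -1, 0, 0, 1⟩, ⟨-1, 0, 1, 0, 2, 0⟩,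
      ⟨2, 0, -1, 0, -2, 0⟩, ⟨-1, 0, 1, 0, 1, 0⟩]⟩,
   ⟨[2, 3, 4, 6, 8, 10], 1,
    [⟨-4, 1, 1, 1, 0, 0⟩, ⟨1, -1, 0, 0, 1, 0⟩, ⟨-1, 0, -1, 0, 0, 1⟩, ⟨-3, 2, 1, 0, 0, 0⟩,
      ⟨4, -2, -1, 0, 0, 0⟩, ⟨-2, 1, 1, 0, 0, 0⟩]⟩,
   ⟨[0, 2, 5, 6, 8, 10], 1,
    [⟨1, 1, 2, 0, -1, -2⟩, ⟨-4, 0, 0, 1, 1, 1⟩, ⟨1, 0, 1, 0, 0, -1⟩, ⟨-4, 0, -2, 0, 2, 3⟩,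
      ⟨4, 0, 1, 0, -2, -2⟩, ⟨-3, 0, -1, 0, 1, 2⟩]⟩,
   ⟨[0, 1, 2, 4, 5, 8], 1,
    [⟨-1, 1, 0, 0, 1, 0⟩, ⟨-1, 0, 1, 0, -1, 0⟩, ⟨-2, 0, 0, 1, 1, 0⟩, ⟨-2, 0, 0, 0, 0, 1⟩,
      ⟨0, 0, 0, 0, 1, 0⟩, ⟨1, 0, 0, 0, -1, 0⟩]⟩,
   ⟨[0, 1, 3, 4, 8, 10], 1,
    [⟨1, 1, 0, -1, 0, 0⟩, ⟨-5, 0, 1, 2, 0, 0⟩, ⟨2, 0, 0, -1, 1, 0⟩, ⟨-6, 0, 0, 2, 0, 1⟩,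
      ⟨1, 0, 0, 0, 0, 0⟩, ⟨2, 0, 0, -1, 0, 0⟩]⟩,
   ⟨[0, 1, 3, 6, 8, 10], 1,
    [⟨-5, 1, 0, 1, 0, 1⟩, ⟨1, 0, 1, 0, 0, -1⟩, ⟨-4, 0, 0, 1, 1, 1⟩, ⟨6, 0, 0, -2, 0, -1⟩,
      ⟨-5, 0, 0, 2, 0, 1⟩, ⟨2, 0, 0, -1, 0, 0⟩]⟩,
   ⟨[0, 1, 3, 5, 8, 10], 2,
    [⟨2, 2, 0, -2, 0, 0⟩, ⟨-4, 0, 2, 2, 0, -1⟩, ⟨-8, 0, 0, 2, 2, 2⟩, ⟨6, 0, 0, -2, 0, -1⟩,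
      ⟨-4, 0, 0, 2, 0, 1⟩, ⟨-2, 0, 0, 0, 0, 1⟩]⟩,
   ⟨[1, 3, 4, 8, 9, 10], 2,
    [⟨-8, 2, 2, 2, 0, 0⟩, ⟨1, -3, 0, 1, 2, 0⟩, ⟨-8, 4, 0, 0, 0, 2⟩, ⟨1, -1, 0, 1, 0, 0⟩,
      ⟨1, 1, 0, -1, 0, 0⟩, ⟨3, -1, 0, -1, 0, 0⟩]⟩,
   ⟨[1, 3, 5, 6, 8, 10], 2,
    [⟨-3, 1, 2, 1, 0, -1⟩, ⟨-8, 0, 0, 2, 2, 2⟩, ⟨5, -1, 0, -1, 0, -1⟩, ⟨2, 2, 0, -2, 0, 0⟩,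
      ⟨-5, -1, 0, 3, 0, 1⟩, ⟨-1, 1, 0, -1, 0, 1⟩]⟩,
   ⟨[0, 1, 4, 5, 8, 10], 2,
    [⟨2, 2, 0, -2, 0, 0⟩, ⟨-8, 0, 2, 3, 1, 0⟩, ⟨-8, 0, 0, 2, 2, 2⟩, ⟨2, 0, 0, -1, 1, 0⟩,
      ⟨0, 0, 0, 1, -1, 0⟩, ⟨2, 0, 0, -1, -1, 0⟩]⟩,
   ⟨[1, 2, 4, 5, 6, 10], 2,
    [⟨-6, 2, 2, 0, 2, 0⟩, ⟨-1, -1, 0, 2, -1, 0⟩, ⟨-7, 1, 0, 0, 3, 2⟩, ⟨1, -1, 0, 0, 1, 0⟩,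
      ⟨1, 1, 0, 0, -1, 0⟩, ⟨2, 0, 0, 0, -2, 0⟩]⟩,
   ⟨[1, 2, 4, 6, 10, 11], 1,
    [⟨-3, 1, 1, 0, 1, 0⟩, ⟨0, -1, 0, 1, 0, 0⟩, ⟨-3, 0, 0, 0, 2, 1⟩, ⟨0, 1, 0, 0, -1, 0⟩,
      ⟨0, 1, 0, 0, -2, 0⟩, ⟨1, -1, 0, 0, 1, 0⟩]⟩,
   ⟨[0, 1, 2, 5, 6, 10], 1,
    [⟨-7, 1, 0, 0, 3, 2⟩, ⟨4, 0, 1, 0, -2, -2⟩, ⟨-4, 0, 0, 1, 1, 1⟩, ⟨-3, 0, 0, 0, 2, 1⟩,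
      ⟨4, 0, 0, 0, -2, -1⟩, ⟨1, 0, 0, 0, -1, 0⟩]⟩,
   ⟨[1, 4, 5, 6, 8, 10], 2,
    [⟨-7, 1, 2, 2, 1, 0⟩, ⟨-8, 0, 0, 2, 2, 2⟩, ⟨1, -1, 0, 0, 1, 0⟩, ⟨2, 2, 0, -2, 0, 0⟩,
      ⟨-1, -1, 0, 2, -1, 0⟩, ⟨3, 1, 0, -2, -1, 0⟩]⟩,
   ⟨[1, 4, 6, 8, 9, 10], 1,
    [⟨-4, 1, 1, 1, 0, 0⟩, ⟨-3, -1, 0, 1, 2, 1⟩, ⟨-1, 3, 0, -1, -2, 0⟩, ⟨1, -2, 0, 1, 1, 0⟩,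
      ⟨1, -1, 0, 0, 1, 0⟩, ⟨1, 1, 0, -1, -1, 0⟩]⟩,
   ⟨[0, 3, 4, 5, 8, 10], 1,
    [⟨1, 1, 0, -1, 0, 0⟩, ⟨-8, 0, 2, 3, 1, 0⟩, ⟨4, 0, -2, -2, 0, 1⟩, ⟨5, 0, -1, -2, 0, 0⟩,
      ⟨-4, 0, 1, 2, 0, 0⟩, ⟨-3, 0, 1, 1, 0, 0⟩]⟩,
   ⟨[0, 1, 4, 5, 6, 10], 1,
    [⟨1, 1, 0, -2, 1, 0⟩, ⟨-4, 0, 1, 2, 0, 0⟩, ⟨-4, 0, 0, 1, 1, 1⟩, ⟨1, 0, 0, -1, 1, 0⟩,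
      ⟨0, 0, 0, 1, -1, 0⟩, ⟨1, 0, 0, 0, -1, 0⟩]⟩]

/-- Linear automorphisms of the cone, together with their inverses. -/
def symmetries : List (Mat6 × Mat6) :=
  [(⟨⟨1, 0, 0, 0, 0, 0⟩, ⟨0, 1, 0, 0, 0, 0⟩, ⟨0, 0, 1, 0, 0, 0⟩, ⟨0, 0, 0, 1, 0, 0⟩,
      ⟨0, 0, 0, 0, 1, 0⟩, ⟨0, 0, 0, 0, 0, 1⟩⟩,
    ⟨⟨1, 0, 0, 0, 0, 0⟩, ⟨0, 1, 0, 0, 0, 0⟩, ⟨0, 0, 1, 0, 0, 0⟩, ⟨0, 0, 0, 1, 0, 0⟩,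
      ⟨0, 0, 0, 0, 1, 0⟩, ⟨0, 0, 0, 0, 0, 1⟩⟩),
   (⟨⟨1, 0, 0, 0, 0, 0⟩, ⟨0, 1, 0, 0, 0, 0⟩, ⟨0, 0, 0, 0, 0, 1⟩, ⟨0, 0, 0, 0, 1, 0⟩,
      ⟨0, 0, 0, 1, 0, 0⟩, ⟨0, 0, 1, 0, 0, 0⟩⟩,
    ⟨⟨1, 0, 0, 0, 0, 0⟩, ⟨0, 1, 0, 0, 0, 0⟩, ⟨0, 0, 0, 0, 0, 1⟩, ⟨0, 0, 0, 0, 1, 0⟩,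
      ⟨0, 0, 0, 1, 0, 0⟩, ⟨0, 0, 1, 0, 0, 0⟩⟩),
   (⟨⟨-3, 1, 0, 0, 1, 1⟩, ⟨-3, 0, 0, 0, 2, 1⟩, ⟨-6, 2, 0, 1, 1, 2⟩, ⟨-3, 1, 1, 0, 1, 0⟩,
      ⟨-6, 1, 0, 0, 2, 2⟩, ⟨-2, 2, 0, 0, 0, 1⟩⟩,
    ⟨⟨-2, 1, 0, 0, 0, 1⟩, ⟨2, 0, 0, 0, -1, 0⟩, ⟨-9, 2, 0, 1, 2, 3⟩, ⟨-1, 1, 1, 0, -1, 0⟩,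
      ⟨1, 1, 0, 0, -1, 0⟩, ⟨-8, 2, 0, 0, 2, 3⟩⟩),
   (⟨⟨-2, 1, 0, 0, 0, 1⟩, ⟨2, 0, 0, 0, -1, 0⟩, ⟨-9, 2, 0, 1, 2, 3⟩, ⟨-1, 1, 1, 0, -1, 0⟩,
      ⟨1, 1, 0, 0, -1, 0⟩, ⟨-8, 2, 0, 0, 2, 3⟩⟩,
    ⟨⟨-3, 1, 0, 0, 1, 1⟩, ⟨-3, 0, 0, 0, 2, 1⟩, ⟨-6, 2, 0, 1, 1, 2⟩, ⟨-3, 1, 1, 0, 1, 0⟩,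
      ⟨-6, 1, 0, 0, 2, 2⟩, ⟨-2, 2, 0, 0, 0, 1⟩⟩),
   (⟨⟨-2, 1, 1, 0, 0, 0⟩, ⟨2, 0, 0, -1, 0, 0⟩, ⟨-9, 2, 3, 2, 1, 0⟩, ⟨-1, 1, 0, -1, 0, 1⟩,
      ⟨1, 1, 0, -1, 0, 0⟩, ⟨-8, 2, 3, 2, 0, 0⟩⟩,
    ⟨⟨-3, 1, 0, 0, 1, 1⟩, ⟨-3, 0, 0, 0, 2, 1⟩, ⟨-2, 2, 0, 0, 0, 1⟩, ⟨-6, 1, 0, 0, 2, 2⟩,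
      ⟨-3, 1, 1, 0, 1, 0⟩, ⟨-6, 2, 0, 1, 1, 2⟩⟩),
   (⟨⟨-3, 0, 1, 1, 1, 0⟩, ⟨-3, 1, 2, 1, 0, -1⟩, ⟨-6, 0, 0, 1, 3, 2⟩, ⟨-3, 0, 2, 2, 0, -1⟩,
      ⟨1, 0, 1, 0, 0, -1⟩, ⟨-9, 0, 1, 2, 3, 2⟩⟩,
    ⟨⟨-3, 0, 1, 1, 1, 0⟩, ⟨-3, 1, 2, 1, 0, -1⟩, ⟨-6, 0, 0, 1, 3, 2⟩, ⟨-3, 0, 2, 2, 0, -1⟩,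
      ⟨1, 0, 1, 0, 0, -1⟩, ⟨-9, 0, 1, 2, 3, 2⟩⟩),
   (⟨⟨-2, 1, 1, 0, 0, 0⟩, ⟨2, 0, 0, -1, 0, 0⟩, ⟨-8, 2, 3, 2, 0, 0⟩, ⟨1, 1, 0, -1, 0, 0⟩,
      ⟨-1, 1, 0, -1, 0, 1⟩, ⟨-9, 2, 3, 2, 1, 0⟩⟩,
    ⟨⟨-3, 1, 1, 1, 0, 0⟩, ⟨-3, 0, 1, 2, 0, 0⟩, ⟨-2, 2, 1, 0, 0, 0⟩, ⟨-6, 1, 2, 2, 0, 0⟩,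
      ⟨-3, 1, 0, 1, 0, 1⟩, ⟨-6, 2, 2, 1, 1, 0⟩⟩)]

/-- Cells of a regular triangulation, up to symmetry. -/
def cells : List Cell :=
  [⟨[⟨0, 0, 1, 0, 0, 0⟩, ⟨0, 0, 0, 1, 0, 0⟩, ⟨0, 0, 0, 0, 1, 0⟩, ⟨0, 0, 0, 0, 0, 1⟩,
      ⟨0, -1, 2, -1, -1, 2⟩, ⟨1, 1, 2, 1, 1, 2⟩],
    ⟨-2, 2, 2, 2, 2, 2⟩,
    [(2, 3, 1), (5, 1, 1), (5, 1, 0), (2, 3, 0), (5, 2, 0)],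
    ⟨10, 0, 0, 0, 0, 0⟩, 10,
  .split 5 3 1 1 1 ⟨1, 1, 2, 1, 1, 3⟩
   (.leaf [0])
   (.split 5 1 1 1 1 ⟨1, 1, 2, 2, 1, 2⟩
    (.leaf [1])
    (.split 0 3 1 1 1 ⟨1, 1, 3, 1, 1, 3⟩
     (.leaf [2, 3, 4, 5, 6])
     (.leaf [7, 4, 5])))⟩,
   ⟨[⟨0, 1, 0, 0, 0, 0⟩, ⟨0, 0, 1, 0, 0, 0⟩, ⟨0, 0, 0, 1, 0, 0⟩, ⟨0, 0, 0, 0, 0, 1⟩,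
      ⟨0, -1, 2, -1, -1, 2⟩, ⟨1, 1, 2, 1, 1, 2⟩],
    ⟨-2, 0, 2, 2, 4, 2⟩,
    [(3, 0, 0), (3, 4, 0), (3, 1, 1), (2, 3, 2), (3, 2, 0)],
    ⟨6, 0, 0, 0, 0, 0⟩, 6,
  .leaf [8]⟩,
   ⟨[⟨0, 1, 0, 0, 0, 0⟩, ⟨0, 0, 1, 0, 0, 0⟩, ⟨0, 0, 0, 1, 0, 0⟩, ⟨0, 0, 0, 0, 1, 0⟩,
      ⟨0, 0, 0, 0, 0, 1⟩, ⟨1, 1, 2, 1, 1, 2⟩],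
    ⟨0, 0, 2, 2, 2, 2⟩,
    [(3, 0, 0), (2, 3, 4), (3, 1, 1), (3, 1, 0), (2, 3, 3)],
    ⟨6, 0, 0, 0, 0, 0⟩, 6,
  .leaf [9]⟩,
   ⟨[⟨0, 0, 1, 0, 0, 0⟩, ⟨0, 0, 0, 1, 0, 0⟩, ⟨0, 0, 0, 0, 1, 0⟩, ⟨1, 0, 2, 1, 1, 2⟩,
      ⟨0, -1, 2, -1, -1, 2⟩, ⟨1, 1, 2, 1, 1, 2⟩],
    ⟨-22, 12, 2, 2, 2, 7⟩,
    [(6, 3, 1), (15, 4, 3), (5, 2, 2), (3, 0, 0), (5, 1, 3)],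
    ⟨-30, 30, 0, 0, 0, 15⟩, 30,
  .split 5 4 1 1 1 ⟨1, 0, 4, 0, 0, 4⟩
   (.split 3 5 1 1 1 ⟨2, 0, 6, 1, 1, 6⟩
    (.leaf [10])
    (.leaf [11]))
   (.split 3 4 1 1 1 ⟨2, 0, 6, 1, 1, 6⟩
    (.split 5 4 1 1 1 ⟨2, 1, 6, 1, 1, 6⟩
     (.leaf [12])
     (.leaf [13]))
    (.leaf [13]))⟩,
   ⟨[⟨0, 1, 0, 0, 0, 0⟩, ⟨0, 0, 0, 1, 0, 0⟩, ⟨0, 0, 0, 0, 0, 1⟩, ⟨1, 1, 1, 2, 0, 2⟩,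
      ⟨0, -1, 2, -1, -1, 2⟩, ⟨1, 1, 2, 1, 1, 2⟩],
    ⟨-10, 0, 4, 2, 8, 2⟩,
    [(1, 4, 4), (2, 1, 5), (4, 3, 2), (2, 1, 0), (4, 3, 6)],
    ⟨-4, 0, 4, 0, 8, 0⟩, 12,
  .split 5 1 1 2 1 ⟨2, 2, 4, 3, 2, 4⟩
   (.split 5 1 2 1 1 ⟨1, 1, 2, 2, 1, 2⟩
    (.split 5 2 1 1 1 ⟨1, 1, 2, 2, 1, 3⟩
     (.split 5 0 1 1 1 ⟨1, 2, 2, 2, 1, 3⟩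
      (.split 3 5 1 2 1 ⟨3, 4, 4, 6, 1, 7⟩
       (.leaf [14])
       (.leaf [15]))
      (.split 3 0 1 2 1 ⟨3, 4, 4, 6, 1, 7⟩
       (.leaf [0])
       (.leaf [16])))
     (.split 5 4 1 2 1 ⟨2, 1, 6, 3, 1, 6⟩
      (.split 0 2 1 1 1 ⟨1, 2, 2, 2, 1, 3⟩
       (.split 3 0 1 2 1 ⟨3, 4, 4, 6, 1, 7⟩
        (.split 5 0 1 1 1 ⟨3, 3, 8, 5, 2, 9⟩
         (.leaf [0])
         (.leaf [1]))
        (.leaf [1]))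
       (.split 3 2 1 2 1 ⟨3, 4, 4, 6, 1, 7⟩
        (.split 5 0 1 1 2 ⟨2, 3, 6, 3, 1, 6⟩
         (.leaf [14])
         (.split 5 2 1 1 1 ⟨3, 3, 8, 5, 2, 9⟩
          (.leaf [0])
          (.split 5 0 2 1 1 ⟨2, 2, 6, 3, 1, 6⟩
           (.leaf [0])
           (.leaf [1]))))
        (.leaf [17])))
      (.leaf [18])))
    (.split 5 2 1 1 2 ⟨2, 2, 4, 3, 2, 6⟩
     (.leaf [19])
     (.split 5 0 1 1 1 ⟨2, 3, 4, 3, 2, 4⟩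
      (.leaf [20])
      (.split 5 2 2 1 1 ⟨2, 2, 4, 3, 2, 5⟩
       (.leaf [20])
       (.leaf [21, 22, 23])))))
   (.split 4 1 1 1 2 ⟨4, 3, 10, 5, 3, 10⟩
    (.leaf [18])
    (.split 5 3 1 2 1 ⟨3, 3, 5, 4, 2, 6⟩
     (.split 0 3 1 2 1 ⟨1, 3, 1, 2, 0, 2⟩
      (.split 2 1 1 4 1 ⟨4, 3, 10, 5, 3, 14⟩
       (.split 5 0 2 1 1 ⟨2, 3, 3, 3, 1, 4⟩
        (.split 1 0 1 1 1 ⟨5, 6, 11, 7, 3, 12⟩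
         (.leaf [20])
         (.split 2 5 1 1 3 ⟨10, 12, 19, 14, 6, 26⟩
          (.split 3 2 1 5 1 ⟨15, 17, 24, 24, 6, 36⟩
           (.split 0 2 1 5 1 ⟨35, 42, 74, 49, 21, 86⟩
            (.split 5 2 1 5 1 ⟨20, 27, 34, 29, 11, 46⟩
             (.split 5 1 4 3 5 ⟨20, 24, 38, 28, 12, 47⟩
              (.leaf [24, 25, 22])
              (.leaf [26]))
             (.leaf [27]))
            (.leaf [27]))
           (.leaf [17]))
          (.leaf [24, 22, 28])))
        (.split 1 0 1 1 3 ⟨10, 12, 19, 14, 6, 22⟩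
         (.split 2 0 1 1 3 ⟨10, 12, 19, 14, 6, 26⟩
          (.split 5 0 1 1 1 ⟨5, 6, 8, 7, 3, 10⟩
           (.leaf [29])
           (.leaf [24, 22, 28]))
          (.leaf [24, 22, 28]))
         (.leaf [24, 22, 28])))
       (.leaf [30]))
      (.split 2 1 1 4 1 ⟨4, 3, 10, 5, 3, 14⟩
       (.split 1 3 1 1 2 ⟨6, 9, 12, 9, 3, 14⟩
        (.split 5 3 2 1 1 ⟨2, 3, 3, 3, 1, 4⟩
         (.leaf [20])
         (.leaf [31]))
        (.leaf [31]))
       (.leaf [30])))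
     (.leaf [31])))⟩]

/-- A vector of the cone outside every unimodular subcone. -/
def witness : V6 := ⟨184, 174, 407, 232, 97, 494⟩

/-- Obstructions to `witness` lying in a unimodular subcone, for all sets of six generators. -/
def obstructions : List Obstruction :=
  [⟨3835, ⟨1, 1, 0, -2, 1, 0⟩, 0⟩,
   ⟨3055, ⟨3, 0, 1, 0, 0, -2⟩, 0⟩,
   ⟨3775, ⟨-3, 0, 1, 0, 1, 0⟩, 0⟩,
   ⟨4089, ⟨4, 0, -2, -2, 0, 1⟩, 0⟩,
   ⟨4071, ⟨4, 0, 1, 0, -2, -2⟩, 0⟩,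
   ⟨1023, ⟨-2, 0, 0, 1, 1, 0⟩, 0⟩,
   ⟨3518, ⟨0, -2, 0, 1, 1, 0⟩, 0⟩,
   ⟨3580, ⟨4, -2, -1, 0, 0, 0⟩, 0⟩,
   ⟨1375, ⟨-5, 1, 0, 1, 0, 1⟩, 0⟩,
   ⟨3869, ⟨1, 0, 1, 0, 0, 0⟩, 2⟩,
   ⟨3415, ⟨0, 1, 0, 0, -2, 0⟩, 0⟩,
   ⟨1997, ⟨1, 0, 1, 0, 0, 1⟩, 2⟩,
   ⟨1879, ⟨-5, 4, 1, 0, -2, 0⟩, 0⟩,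
   ⟨1839, ⟨0, 0, 0, 0, 0, 1⟩, 2⟩,
   ⟨2967, ⟨0, 0, 0, 0, 1, 0⟩, 2⟩,
   ⟨1978, ⟨1, 1, 0, 1, 0, 0⟩, 2⟩,
   ⟨3946, ⟨1, 1, 0, 1, 0, 1⟩, 2⟩,
   ⟨1526, ⟨1, 1, 0, 0, 1, 0⟩, 2⟩,
   ⟨1277, ⟨0, 0, 1, 0, 0, 0⟩, 2⟩,
   ⟨3828, ⟨1, 1, 1, 0, 1, 0⟩, 2⟩,
   ⟨3507, ⟨0, 0, 0, 1, 1, 0⟩, 2⟩,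
   ⟨2933, ⟨1, 0, 1, 0, 1, 0⟩, 2⟩,
   ⟨3279, ⟨1, 0, 0, 0, 0, 1⟩, 2⟩,
   ⟨2523, ⟨0, 0, 0, 1, 0, 0⟩, 2⟩,
   ⟨2686, ⟨0, 1, 0, 0, 0, 0⟩, 2⟩,
   ⟨3923, ⟨0, 4, 0, -2, -3, 0⟩, 0⟩,
   ⟨1631, ⟨-9, 4, 1, 0, 0, 1⟩, 0⟩,
   ⟨1482, ⟨1, 1, 0, 1, 0, 1⟩, 3⟩,
   ⟨1940, ⟨1, 1, 1, 0, 1, 0⟩, 3⟩,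
   ⟨1419, ⟨1, 0, 0, 3, 0, 4⟩, 5⟩,
   ⟨2418, ⟨0, 1, 0, 1, 2, 0⟩, 3⟩,
   ⟨3339, ⟨0, 0, 0, 1, 0, 2⟩, 3⟩,
   ⟨1844, ⟨0, 1, 4, 0, 2, 0⟩, 5⟩,
   ⟨2262, ⟨0, 1, 0, 0, 1, 0⟩, 3⟩,
   ⟨2261, ⟨1, 0, 3, 0, 4, 0⟩, 5⟩,
   ⟨1333, ⟨1, 0, 2, 0, 1, 0⟩, 3⟩,
   ⟨3660, ⟨0, 1, 1, 0, 0, 1⟩, 3⟩,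
   ⟨1429, ⟨1, 0, 4, 0, 3, 0⟩, 5⟩,
   ⟨1134, ⟨1, 2, 0, 0, 0, 1⟩, 3⟩,
   ⟨1644, ⟨1, 4, 1, 0, 0, 1⟩, 5⟩,
   ⟨2866, ⟨0, 1, 0, 2, 3, 0⟩, 5⟩,
   ⟨2842, ⟨0, 1, 0, 1, 0, 0⟩, 3⟩,
   ⟨2141, ⟨0, 0, 1, 0, 0, 0⟩, 3⟩]

/-- The generators as a family. -/
def gen (i : Fin 12) : V6 := gens.get i

/-- The simplices as a family. -/
def simplex (i : Fin 32) : Simplex := simplices.get i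

/-- The cells as a family. -/
def cell (i : Fin 5) : Cell := cells.get i

/-- The symmetries as a family. -/
def symmetry (i : Fin 7) : Mat6 × Mat6 := symmetries.get i

/-- The functional cutting out the facet of a cell towards a neighbour. -/
def Cell.nbrRow (C : Cell) (n : ℤ × Fin 5 × Fin 7) : V6 :=
  smul n.1 (((symmetry n.2.2).1.pull (cell n.2.1).rho).add (smul (-1) C.rho))

/-- The coordinates of a cell with respect to its rays. -/
def Cell.rows (C : Cell) : List V6 := C.nbrs.map C.nbrRow ++ [C.facet]

/-- The vector `x` is a nonnegative combination of at most six generators. -/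
def Rep (x : V6) : Prop :=
  ∃ (c : List ℤ) (I : List (Fin 12)), I.length ≤ 6 ∧ (∀ t ∈ c, 0 ≤ t) ∧ x = lin c (I.map gen)

/-- The vector `x` satisfies all inequalities valid for the generators. -/
def Pos (x : V6) : Prop := ∀ h : V6, (∀ i, 0 ≤ h.dot (gen i)) → 0 ≤ h.dot x

/-- Correctness of the data of a simplex. -/
def Simplex.valid (S : Simplex) : Bool :=
  decide (S.idx.length ≤ 6) && decide (0 < S.den) && decide (S.den ∣ 2) &&
    isDual S.den S.rows (S.idx.map gen)

/-- The cone on `K` is contained in the simplex. -/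
def Simplex.contains (S : Simplex) (K : List V6) : Bool :=
  S.rows.all fun r => K.all fun v => decide (0 ≤ r.dot v)

/-- The residue class of `e` belongs to the lattice of the simplex. -/
def Simplex.hits (S : Simplex) (e : V6) : Bool :=
  S.rows.all fun r => decide (S.den ∣ r.dot e)

/-- All lattice points in the cone on `K` are representable, as certified by the tree. -/
def SplitTree.check : SplitTree → List V6 → Bool
  | .leaf L, K => (L.all fun k => (simplex k).contains K) &&
      residues.all fun e => L.any fun k => (simplex k).hits e
  | .split i j s a b v l r, K =>
      decide (i ≠ j) && decide (0 < s) && decide (0 < a) && decide (0 < b) &&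
      (if h : i < K.length ∧ j < K.length then
        decide (smul s v = (smul a (K[i]'h.1)).add (smul b (K[j]'h.2))) else false) &&
      l.check (K.set i v) && r.check (K.set j v)

theorem simplex_valid : ∀ k, (simplex k).valid = true := by decide +kernel

theorem Rep.of_simplex {S : Simplex} {K : List V6} {x : V6} (hS : S.valid = true)
    (hK : S.contains K = true) (hx : InCone K x) (he : S.hits x.mod2 = true) : Rep x := by
  simp only [Simplex.valid, Bool.and_eq_true, decide_eq_true_eq] at hS
  obtain ⟨⟨⟨h6, hd⟩, h2⟩, hdual⟩ := hS
  simp only [Simplex.contains, Simplex.hits, List.all_eq_true, decide_eq_true_eq] at hK he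
  have hdvd : ∀ r ∈ S.rows, S.den ∣ r.dot x := fun r hr =>
    (dvd_iff_dvd_of_dvd_sub (h2.trans (two_dvd_dot_sub_dot_mod2 r x))).2 (he r hr)
  refine ⟨(pairings S.rows x).map (· / S.den), S.idx, h6, ?_, ?_⟩
  · simp only [pairings, List.map_map, List.mem_map, Function.comp]
    rintro _ ⟨r, hr, rfl⟩
    exact Int.ediv_nonneg (hx.dot_nonneg (hK r hr)) hd.le
  · apply smul_cancel hd
    rw [← isDual.lin_eq hdual x, ← lin_map_mul, List.map_map]
    congr 1
    conv_lhs => rw [← List.map_id (pairings S.rows x)]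
    refine List.map_congr_left fun t ht => ?_
    obtain ⟨r, hr, rfl⟩ := List.mem_map.1 ht
    exact (Int.mul_ediv_cancel' (hdvd r hr)).symm

theorem SplitTree.check.rep {T : SplitTree} {K : List V6} {x : V6} (hT : T.check K = true)
    (hx : InCone K x) : Rep x := by
  induction T generalizing K with
  | leaf L =>
    simp only [check, Bool.and_eq_true, List.all_eq_true, List.any_eq_true] at hT
    obtain ⟨k, hk, he⟩ := hT.2 _ (mod2_mem_residues x)
    exact .of_simplex (simplex_valid k) (hT.1 k hk) hx he
  | split i j s a b v l r ihl ihr =>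
    simp only [check, Bool.and_eq_true, decide_eq_true_eq] at hT
    obtain ⟨⟨⟨⟨⟨⟨hij, hs⟩, ha⟩, hb⟩, hv⟩, hl⟩, hr⟩ := hT
    split at hv
    · rename_i h
      exact (hx.split h.1 h.2 hij hs ha hb (of_decide_eq_true hv)).elim (ihl hl) (ihr hr)
    · cases hv

theorem tree_check : ∀ k, (cell k).tree.check (cell k).rays = true := by decide +kernel

theorem cell_isDual : ∀ k, isDual (cell k).den (cell k).rows (cell k).rays = true := by
  decide +kernel

theorem cell_length : ∀ k, (cell k).rows.length = (cell k).rays.length ∧ 0 < (cell k).den := by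
  decide +kernel

theorem cell_weight_pos : ∀ k, ∀ n ∈ (cell k).nbrs, 0 < n.1 := by decide +kernel

theorem cell_facet_nonneg : ∀ k i, 0 ≤ (cell k).facet.dot (gen i) := by decide +kernel

theorem cell_rho_nonneg : ∀ k i, 0 ≤ (cell k).rho.dot (gen i) := by decide +kernel

theorem symmetry_gen : ∀ s i, ∃ j, (symmetry s).1.app (gen i) = gen j := by decide +kernel

theorem symmetry_inv_gen : ∀ s i, ∃ j, (symmetry s).2.app (gen i) = gen j := by decide +kernel

theorem symmetry_inv_basis :
    ∀ s, ∀ e ∈ basis, (symmetry s).2.app ((symmetry s).1.app e) = e := by decide +kernel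

theorem symmetry_inv (s : Fin 7) (x : V6) :
    (symmetry s).2.app ((symmetry s).1.app x) = x := by
  have hx : x = lin [x.a, x.b, x.c, x.d, x.e, x.f] basis := by
    simp [basis, lin, add, smul, zero]
  conv_lhs => rw [hx]
  rw [Mat6.app_lin, Mat6.app_lin, List.map_map, List.map_congr_left (g := id)]
  · rw [List.map_id, ← hx]
  · exact symmetry_inv_basis s

theorem Pos.app {x : V6} (hx : Pos x) (s : Fin 7) : Pos ((symmetry s).1.app x) := by
  intro h hh
  rw [← Mat6.pull_dot]
  refine hx _ fun i => ?_
  rw [Mat6.pull_dot]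
  obtain ⟨j, hj⟩ := symmetry_gen s i
  rw [hj]
  exact hh j

theorem Rep.of_app {x : V6} (s : Fin 7) (hx : Rep ((symmetry s).1.app x)) : Rep x := by
  obtain ⟨c, I, hI, hc, e⟩ := hx
  choose π hπ using symmetry_inv_gen s
  refine ⟨c, I.map π, by simpa using hI, hc, ?_⟩
  rw [← symmetry_inv s x, e, Mat6.app_lin, List.map_map, List.map_map]
  congr 1
  exact List.map_congr_left fun i _ => hπ i

/-- Walking through the triangulation, along which `rho` decreases. -/
theorem Pos.rep_of_rho (n : ℕ) : ∀ (k : Fin 5) (x : V6), Pos x →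
    ((cell k).rho.dot x).toNat = n → Rep x := by
  induction n using Nat.strong_induction_on with
  | _ n ih =>
    intro k x hx hn
    by_cases hall : ∀ b ∈ (cell k).nbrs, 0 ≤ ((cell k).nbrRow b).dot x
    · refine SplitTree.check.rep (tree_check k)
        ⟨(cell k).den, pairings (cell k).rows x, (cell_length k).2, ?_, ?_,
        (isDual.lin_eq (cell_isDual k) x).symm⟩
      · simpa [pairings] using (cell_length k).1
      · refine mem_pairings_nonneg fun r hr => ?_
        rcases List.mem_append.1 hr with hr | hr
        · obtain ⟨b, hb, rfl⟩ := List.mem_map.1 hr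
          exact hall b hb
        · rw [List.mem_singleton.1 hr]
          exact hx _ (cell_facet_nonneg k)
    · push Not at hall
      obtain ⟨b, hb, hlt⟩ := hall
      have hw := cell_weight_pos k b hb
      rw [Cell.nbrRow, smul_dot, add_dot, smul_dot, Mat6.pull_dot] at hlt
      have hlt' := (pos_iff_neg_of_mul_neg hlt).1 hw
      have hx' := hx.app b.2.2
      have h0 := hx' _ (cell_rho_nonneg b.2.1)
      exact .of_app b.2.2 (ih _ (by omega) b.2.1 _ hx' rfl)

theorem Pos.rep {x : V6} (hx : Pos x) : Rep x := Pos.rep_of_rho _ 0 x hx rfl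

/-- The cone under consideration. -/
def cone : Set (Fin 6 → ℝ) := coneFin fun i => (gen i).vec

theorem cone_eq_coneSet :
    cone = coneSet ((Finset.univ.image fun i => (gen i).vec : Finset (Fin 6 → ℤ)) :
      Set (Fin 6 → ℤ)) := by
  ext y
  constructor
  · rintro ⟨a, ha, rfl⟩
    exact ⟨12, _, a, fun i => by simp, ha, rfl⟩
  · rintro ⟨n, v, a, hv, ha, rfl⟩
    have : ∀ k, ∃ i, (gen i).vec = v k := fun k => by simpa using hv k
    choose I hI using this
    refine ⟨fun i => ∑ k with I k = i, a k, fun i => Finset.sum_nonneg fun k _ => ha k, ?_⟩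
    rw [← Finset.sum_fiberwise Finset.univ I]
    refine Finset.sum_congr rfl fun i _ => ?_
    rw [Finset.sum_smul]
    refine Finset.sum_congr rfl fun k hk => ?_
    rw [← hI k, (Finset.mem_filter.1 hk).2]

theorem dotR_nonneg_of_mem_coneFin {n : ℕ} {v : Fin n → V6} {h : V6} (hh : ∀ i, 0 ≤ h.dot (v i))
    {y : Fin 6 → ℝ} (hy : y ∈ coneFin fun i => (v i).vec) : 0 ≤ h.dotR y := by
  obtain ⟨a, ha, rfl⟩ := hy
  rw [dotR_sum]
  refine Finset.sum_nonneg fun i _ => ?_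
  rw [dotR_smul, dotR_toR_vec]
  exact mul_nonneg (ha i) (by exact_mod_cast hh i)

theorem pos_of_mem_cone {x : V6} (hx : toR x.vec ∈ cone) : Pos x := fun h hh => by
  have := dotR_nonneg_of_mem_coneFin hh hx
  rw [dotR_toR_vec] at this
  exact_mod_cast this

theorem toR_add {d : ℕ} (x y : Fin d → ℤ) : toR (x + y) = toR x + toR y := by
  ext i; simp [toR]

theorem toR_zsmul {d : ℕ} (n : ℤ) (x : Fin d → ℤ) : toR (n • x) = (n : ℝ) • toR x := by
  ext i; simp [toR]

theorem gen_mem_cone (i : Fin 12) : toR (gen i).vec ∈ cone :=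
  ⟨Pi.single i 1, fun j => by by_cases h : j = i <;> simp [h], by
    simp [Pi.single_apply]⟩

theorem zero_mem_cone : (0 : Fin 6 → ℝ) ∈ cone := ⟨0, fun _ => le_rfl, by simp⟩

theorem add_mem_cone {x y : Fin 6 → ℝ} (hx : x ∈ cone) (hy : y ∈ cone) : x + y ∈ cone := by
  obtain ⟨a, ha, rfl⟩ := hx
  obtain ⟨b, hb, rfl⟩ := hy
  exact ⟨a + b, fun i => add_nonneg (ha i) (hb i), by
    simp [add_smul, Finset.sum_add_distrib]⟩

theorem smul_mem_cone {x : Fin 6 → ℝ} {t : ℝ} (ht : 0 ≤ t) (hx : x ∈ cone) : t • x ∈ cone := by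
  obtain ⟨a, ha, rfl⟩ := hx
  exact ⟨t • a, fun i => mul_nonneg ht (ha i), by simp [Finset.smul_sum, smul_smul]⟩

theorem lin_mem_cone (c : List ℤ) (I : List (Fin 12)) (hc : ∀ t ∈ c, 0 ≤ t) :
    toR (lin c (I.map gen)).vec ∈ cone := by
  have h0 : toR zero.vec ∈ cone := by
    rw [vec_zero]
    convert zero_mem_cone
    ext i; simp [toR]
  induction c generalizing I with
  | nil => exact h0
  | cons n c ih =>
    cases I with
    | nil => exact h0
    | cons i I =>
      rw [List.map_cons, lin, vec_add, vec_smul, toR_add, toR_zsmul]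
      exact add_mem_cone (smul_mem_cone (by exact_mod_cast hc n (by simp)) (gen_mem_cone i))
        (ih I fun t ht => hc t (by simp [ht]))

/-- The functional taking the value one at every generator. -/
def height : V6 := ⟨-5, 1, 1, 1, 1, 1⟩

theorem height_gen : ∀ i, height.dot (gen i) = 1 := by decide +kernel

theorem height_nonneg {y : Fin 6 → ℝ} (hy : y ∈ cone) : 0 ≤ height.dotR y :=
  dotR_nonneg_of_mem_coneFin (fun i => by simp [height_gen i]) hy

theorem eq_zero_of_height_nonpos {y : Fin 6 → ℝ} (hy : y ∈ cone) (h : height.dotR y ≤ 0) :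
    y = 0 := by
  obtain ⟨a, ha, rfl⟩ := hy
  simp only [dotR_sum, dotR_smul, dotR_toR_vec, height_gen, Int.cast_one, mul_one] at h
  have := (Finset.sum_eq_zero_iff_of_nonneg fun i _ => ha i).1
    (le_antisymm h (Finset.sum_nonneg fun i _ => ha i))
  exact Finset.sum_eq_zero fun i hi => by rw [this i hi, zero_smul]

theorem one_le_height {x : Fin 6 → ℤ} (hx : toR x ∈ cone) (h0 : x ≠ 0) :
    1 ≤ height.dot (ofFun x) := by
  by_contra! h
  have h' : height.dotR (toR x) ≤ 0 := by
    rw [← vec_ofFun x, dotR_toR_vec]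
    exact_mod_cast Int.lt_add_one_iff.1 h
  have := eq_zero_of_height_nonpos hx h'
  refine h0 (funext fun i => ?_)
  simpa [toR] using congrFun this i

theorem gen_mem_hilbC (i : Fin 12) : (gen i).vec ∈ hilbC cone := by
  refine ⟨gen_mem_cone i, fun h => ?_, ?_⟩
  · have h1 := height_gen i
    rw [← ofFun_vec (gen i), h] at h1
    simp [dot, ofFun] at h1
  · rintro ⟨u, v, hu, hv, hu0, hv0, e⟩
    have h1 := one_le_height hu hu0
    have h2 := one_le_height hv hv0
    have h3 := height_gen i
    rw [← vec_ofFun u, ← vec_ofFun v, ← vec_add] at e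
    rw [vec_injective e, dot_add] at h3
    omega

theorem exists_gen_of_hilbC_lin (c : List ℤ) (I : List (Fin 12)) (hc : ∀ t ∈ c, 0 ≤ t)
    (h : (lin c (I.map gen)).vec ∈ hilbC cone) : ∃ i, (lin c (I.map gen)).vec = (gen i).vec := by
  induction c generalizing I with
  | nil => exact absurd vec_zero h.2.1
  | cons n c ih =>
    cases I with
    | nil => exact absurd vec_zero h.2.1
    | cons i I =>
      have hc' : ∀ t ∈ c, 0 ≤ t := fun t ht => hc t (by simp [ht])
      rcases (hc n (by simp)).eq_or_lt with rfl | hn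
      · have e : lin (0 :: c) ((i :: I).map gen) = lin c (I.map gen) := by
          simp [lin, add, smul]
        rw [e] at h ⊢
        exact ih I hc' h
      · have e : lin (n :: c) ((i :: I).map gen) =
            (gen i).add (lin ((n - 1) :: c) ((i :: I).map gen)) := by
          simp only [List.map_cons, lin, add, smul, V6.mk.injEq]
          refine ⟨?_, ?_, ?_, ?_, ?_, ?_⟩ <;> ring
        have e' := congrArg vec e
        rw [vec_add] at e'
        by_cases h0 : (lin ((n - 1) :: c) ((i :: I).map gen)).vec = 0
        · exact ⟨i, by rw [e', h0, add_zero]⟩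
        · refine absurd ⟨_, _, gen_mem_cone i, lin_mem_cone _ (i :: I) ?_,
            (gen_mem_hilbC i).2.1, h0, e'⟩ h.2.2
          intro t ht
          rcases List.mem_cons.1 ht with rfl | ht
          · omega
          · exact hc' t ht

theorem exists_gen_of_mem_hilbC {x : Fin 6 → ℤ} (hx : x ∈ hilbC cone) :
    ∃ i, x = (gen i).vec := by
  rw [← vec_ofFun x] at hx ⊢
  obtain ⟨c, I, -, hc, e⟩ := (pos_of_mem_cone hx.1).rep
  rw [e] at hx ⊢
  exact exists_gen_of_hilbC_lin c I hc hx

theorem exists_finset_sum_of_lin (c : List ℤ) (I : List (Fin 12)) (hc : ∀ t ∈ c, 0 ≤ t) :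
    ∃ (s : Finset (Fin 6 → ℤ)) (a : (Fin 6 → ℤ) → ℕ), (s : Set (Fin 6 → ℤ)) ⊆ hilbC cone ∧
      s.card ≤ I.length ∧ (lin c (I.map gen)).vec = ∑ y ∈ s, a y • y := by
  induction c generalizing I with
  | nil => exact ⟨∅, 0, by simp, by simp, by simp [lin, vec_zero]⟩
  | cons n c ih =>
    cases I with
    | nil => exact ⟨∅, 0, by simp, by simp, by simp [lin, vec_zero]⟩
    | cons i I =>
      obtain ⟨s, a, hs, hcard, e⟩ := ih I fun t ht => hc t (by simp [ht])
      lift n to ℕ using hc n (by simp)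
      refine ⟨insert (gen i).vec s,
        fun y => (if y ∈ s then a y else 0) + if y = (gen i).vec then n else 0, ?_, ?_, ?_⟩
      · rw [Finset.coe_insert]
        exact Set.insert_subset (gen_mem_hilbC i) hs
      · exact (Finset.card_insert_le _ _).trans (by simpa using hcard)
      · rw [List.map_cons, lin, vec_add, vec_smul, e, natCast_zsmul, add_comm]
        simp only [add_smul, Finset.sum_add_distrib, ite_smul, zero_smul]
        congr 1
        · rw [← Finset.sum_filter]
          refine Finset.sum_congr ?_ fun _ _ => rfl
          ext y
          simp only [Finset.mem_filter, Finset.mem_insert]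
          tauto
        · simp

/-- Every set of at most `k` of the first `n` elements lies in one of the sets encoded by the
candidates. -/
def covered : ℕ → ℕ → List ℕ → Bool
  | n + 1, k + 1, L =>
      covered n k (L.filter fun m => m.testBit n) && covered n (k + 1) L
  | _, _, L => !L.isEmpty

theorem covered.exists_mem {n k : ℕ} {L : List ℕ} (h : covered n k L = true) (s : Finset ℕ)
    (hs : ∀ i ∈ s, i < n) (hk : s.card ≤ k) : ∃ m ∈ L, ∀ i ∈ s, m.testBit i = true := by
  induction n generalizing k L s with
  | zero =>
    obtain ⟨m, hm⟩ := List.exists_mem_of_ne_nil L (by simpa [covered] using h)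
    exact ⟨m, hm, fun i hi => absurd (hs i hi) (by simp)⟩
  | succ n ih =>
    cases k with
    | zero =>
      obtain ⟨m, hm⟩ := List.exists_mem_of_ne_nil L (by simpa [covered] using h)
      exact ⟨m, hm, fun i hi => absurd hk (by simp [Finset.ne_empty_of_mem hi])⟩
    | succ k =>
      simp only [covered, Bool.and_eq_true] at h
      by_cases hn : n ∈ s
      · obtain ⟨m, hm, hms⟩ := ih h.1 (s.erase n) (fun i hi => by
          have := hs i (Finset.mem_of_mem_erase hi)
          have := Finset.ne_of_mem_erase hi
          omega) (by rw [Finset.card_erase_of_mem hn]; omega)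
        rw [List.mem_filter] at hm
        refine ⟨m, hm.1, fun i hi => ?_⟩
        by_cases hin : i = n
        · exact hin ▸ hm.2
        · exact hms i (Finset.mem_erase.2 ⟨hin, hi⟩)
      · refine ih h.2 s (fun i hi => ?_) hk
        have := hs i hi
        have : i ≠ n := fun e => hn (e ▸ hi)
        omega

theorem obstructions_covered : covered 12 6 (obstructions.map Obstruction.mask) = true := by
  decide +kernel

theorem obstruction_gen : ∀ o ∈ obstructions, ∀ i : Fin 12, o.mask.testBit i = true →
    if o.m = 0 then 0 ≤ o.h.dot (gen i) else o.m ∣ o.h.dot (gen i) := by decide +kernel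

theorem obstruction_witness : ∀ o ∈ obstructions,
    if o.m = 0 then o.h.dot witness < 0 else ∃ e ∈ basis, ¬ o.m ∣ o.h.dot e := by decide +kernel

theorem witness_mem_cone : toR witness.vec ∈ cone := by
  have h : witness = lin [58, 87, 97, 58, 116, 68] ([0, 1, 3, 4, 8, 11].map gen) := by
    decide +kernel
  rw [h]
  exact lin_mem_cone _ _ (by decide)

theorem closure_ne_top_of_dvd {y : Fin 6 → V6} {h : V6} {m : ℤ} (hy : ∀ k, m ∣ h.dot (y k))
    {e : V6} (he : ¬ m ∣ h.dot e) :
    AddSubgroup.closure (Set.range fun k => (y k).vec) ≠ ⊤ := by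
  intro htop
  have key : ∀ x ∈ AddSubgroup.closure (Set.range fun k => (y k).vec), m ∣ h.dot (ofFun x) := by
    intro x hx
    induction hx using AddSubgroup.closure_induction with
    | mem x hx => obtain ⟨k, rfl⟩ := hx; exact hy k
    | zero => simp [dot, ofFun]
    | add u v _ _ hu hv =>
      have e : h.dot (ofFun (u + v)) = h.dot (ofFun u) + h.dot (ofFun v) := by
        simp only [dot, ofFun, Pi.add_apply]; ring
      rw [e]
      exact dvd_add hu hv
    | neg u _ hu =>
      have e : h.dot (ofFun (-u)) = -h.dot (ofFun u) := by
        simp only [dot, ofFun, Pi.neg_apply]; ring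
      rw [e]
      exact dvd_neg.2 hu
  exact he (key e.vec (htop ▸ AddSubgroup.mem_top _))

theorem witness_not_covered (I : Fin 6 → Fin 12)
    (htop : AddSubgroup.closure (Set.range fun k => (gen (I k)).vec) = ⊤)
    (hw : toR witness.vec ∈ coneFin fun k => (gen (I k)).vec) : False := by
  obtain ⟨m, hm, hms⟩ := covered.exists_mem obstructions_covered
    (Finset.univ.image fun k => (I k : ℕ)) (by simp) (Finset.card_image_le.trans (by simp))
  obtain ⟨o, ho, rfl⟩ := List.mem_map.1 hm
  have hI := fun k => obstruction_gen o ho (I k) (hms _ (by simp))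
  have hq := obstruction_witness o ho
  split at hq
  · rename_i h0
    simp only [h0, if_true] at hI
    have := dotR_nonneg_of_mem_coneFin hI hw
    rw [dotR_toR_vec] at this
    exact absurd (by exact_mod_cast this) hq.not_ge
  · rename_i h0
    simp only [h0, if_false] at hI
    obtain ⟨e, -, he⟩ := hq
    exact closure_ne_top_of_dvd hI he htop

theorem fullDim_cone : FullDim cone := by
  rw [FullDim, eq_top_iff]
  intro y _
  have key : ∀ (t : ℝ) i, t • toR (gen i).vec ∈ Submodule.span ℝ cone := fun t i =>
    Submodule.smul_mem _ t (Submodule.subset_span (gen_mem_cone i))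
  have e : y = y 0 • toR (gen 5).vec + y 1 • toR (gen 0).vec +
      (y 2 - 2 * y 0) • toR (gen 1).vec + (y 3 - y 0) • toR (gen 2).vec +
      (y 4 - y 0) • toR (gen 3).vec + (y 5 - 2 * y 0) • toR (gen 4).vec := by
    ext i
    fin_cases i <;> simp [toR, gen, gens, vec] <;> ring
  rw [e]
  exact add_mem (add_mem (add_mem (add_mem (add_mem (key _ _) (key _ _)) (key _ _)) (key _ _))
    (key _ _)) (key _ _)

end ConeUHC

open ConeUHC

/-- There exists a pointed, full-dimensional rational cone `C ⊆ ℝ⁶` that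
satisfies the integral Carathéodory property but is not the union of its
unimodular Hilbert subcones. -/
theorem exists_ICP_not_UHC :
    ∃ C : Set (Fin 6 → ℝ), IsRatCone C ∧ PointedSet C ∧ FullDim C ∧
      (∀ x : Fin 6 → ℤ, toR x ∈ C →
        ∃ (s : Finset (Fin 6 → ℤ)) (a : (Fin 6 → ℤ) → ℕ),
          (s : Set (Fin 6 → ℤ)) ⊆ hilbC C ∧ s.card ≤ 6 ∧ x = ∑ y ∈ s, a y • y) ∧
      ¬ (∀ p ∈ C, ∃ y : Fin 6 → (Fin 6 → ℤ), (∀ k, y k ∈ hilbC C) ∧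
          LinearIndependent ℤ y ∧ AddSubgroup.closure (Set.range y) = ⊤ ∧
          p ∈ coneFin y) := by
  refine ⟨cone, ⟨_, cone_eq_coneSet⟩, fun x hx hx' => ?_, fullDim_cone, fun x hx => ?_, fun h => ?_⟩
  · refine eq_zero_of_height_nonpos hx ?_
    have := height_nonneg hx'
    rw [V6.dotR_neg] at this
    linarith
  · rw [← V6.vec_ofFun x] at hx ⊢
    obtain ⟨c, I, hI, hc, e⟩ := (pos_of_mem_cone hx).rep
    obtain ⟨s, a, hs, hcard, e'⟩ := exists_finset_sum_of_lin c I hc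
    exact ⟨s, a, hs, hcard.trans hI, by rw [e, e']⟩
  · obtain ⟨y, hy, -, htop, hw⟩ := h _ witness_mem_cone
    choose I hI using fun k => exists_gen_of_mem_hilbC (hy k)
    obtain rfl : y = fun k => (gen (I k)).vec := funext hI
    exact witness_not_covered I htop hw
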